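/- (Theorem 3, Nonparametric Identification) Let π be a choice rule and ≻ a preference on X. There exists a monotonic attention rule μ such that (≻, μ) is a RAM representation of π if and only if for every choice problem S and all a, b ∈ S with a ≻ b, π(b|S) − π(b|S−a) ≤ 0. -/

import Mathlib

open Finset
open scoped Classical

variable {α : Type*} [Fintype α] [DecidableEq α]

/-- A choice rule: for every choice problem (nonempty finite set) `S`,
`π S` is a probability distribution supported on `S`. -/
def IsChoiceRule (π : Finset α → α → ℝ) : Prop :=
  ∀ S : Finset α, S.Nonempty →
    (∀ a ∈ S, 0 ≤ π S a) ∧ (∀ a, a ∉ S → π S a = 0) ∧ (∑ a ∈ S, π S a) = 1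

/-- An attention rule: for every choice problem `S`, `μ S` is a probability
distribution over the nonempty subsets of `S`.  `μ S T` is the probability of
paying attention to the consideration set `T` when the choice problem is `S`. -/
def IsAttentionRule (μ : Finset α → Finset α → ℝ) : Prop :=
  ∀ S : Finset α, S.Nonempty →
    (∀ T : Finset α, T ⊆ S → T.Nonempty → 0 ≤ μ S T) ∧
    (∀ T : Finset α, ¬(T ⊆ S ∧ T.Nonempty) → μ S T = 0) ∧
    (∑ T ∈ S.powerset, μ S T) = 1

/-- Assumption 1 (Monotonic attention): `μ(T|S) ≤ μ(T|S−a)` for `a ∈ S − T`. -/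
def MonotonicAttention (μ : Finset α → Finset α → ℝ) : Prop :=
  ∀ S T : Finset α, S.Nonempty → T ⊆ S → T.Nonempty →
    ∀ a ∈ S, a ∉ T → μ S T ≤ μ (S.erase a) T

/-- A preference: a strict linear order (asymmetric, transitive, complete). -/
structure IsPref (r : α → α → Prop) : Prop where
  asymm : ∀ a b, r a b → ¬ r b a
  trans : ∀ a b c, r a b → r b c → r a c
  total : ∀ a b, a ≠ b → r a b ∨ r b a

/-- `a` is the `r`-maximal element of `T`. -/
def IsBest (r : α → α → Prop) (a : α) (T : Finset α) : Prop :=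
  a ∈ T ∧ ∀ b ∈ T, b ≠ a → r a b

/-- `(r, μ)` represents `π` (without the monotonicity requirement on `μ`):
`π(a|S) = Σ_{T ⊆ S} 1(a is r-best in T) μ(T|S)`. -/
noncomputable def Represents (π : Finset α → α → ℝ) (r : α → α → Prop)
    (μ : Finset α → Finset α → ℝ) : Prop :=
  IsChoiceRule π ∧ IsPref r ∧ IsAttentionRule μ ∧
  ∀ S : Finset α, S.Nonempty → ∀ a ∈ S,
    π S a = ∑ T ∈ S.powerset, if IsBest r a T then μ S T else 0

/-- `(r, μ)` is a RAM representation of `π`: a representation with `μ` monotonic. -/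
def IsRAM (π : Finset α → α → ℝ) (r : α → α → Prop)
    (μ : Finset α → Finset α → ℝ) : Prop :=
  Represents π r μ ∧ MonotonicAttention μ

/-- The revealed-preference relation `P`: `a P b` iff `a ≠ b` and there is a
choice problem `S` containing `a` and `b` with `π(a|S) > π(a|S−b)`. -/
def Prel (π : Finset α → α → ℝ) (a b : α) : Prop :=
  a ≠ b ∧ ∃ S : Finset α, a ∈ S ∧ b ∈ S ∧ π S a > π (S.erase b) a

/-- Lower contour set of `a` with respect to the preference `r`. -/
noncomputable def lowerContour (r : α → α → Prop) (a : α) : Finset α :=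
  Finset.univ.filter fun b => b = a ∨ r a b

/-- An attention rule is triangular w.r.t. `r` if it puts weight only on
(intersections of `S` with) lower contour sets. -/
def Triangular (r : α → α → Prop) (μ : Finset α → Finset α → ℝ) : Prop :=
  ∀ S T : Finset α, S.Nonempty → 0 < μ S T → ∃ a ∈ S, T = lowerContour r a ∩ S

/-- A (deterministic) attention filter. -/
def IsAttentionFilter (Γ : Finset α → Finset α) : Prop :=
  ∀ S : Finset α, S.Nonempty →
    Γ S ⊆ S ∧ (Γ S).Nonempty ∧
    ∀ a ∈ S, a ∉ Γ S → (S.erase a).Nonempty → Γ (S.erase a) = Γ S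

/-- An attention filter is triangular w.r.t. `r` if each `Γ(S)` is the
intersection of `S` with a lower contour set of some element of `S`. -/
def TriangularFilter (r : α → α → Prop) (Γ : Finset α → Finset α) : Prop :=
  ∀ S : Finset α, S.Nonempty → ∃ a ∈ S, Γ S = lowerContour r a ∩ S

/-- Assumption 3 (φ-attentive at binaries). -/
def AttentiveAtBinaries (φ : ℝ) (μ : Finset α → Finset α → ℝ) : Prop :=
  ∀ a b : α, a ≠ b →
    μ {a, b} {a, b} ≥ (1 - φ) / φ * max (μ {a, b} {a}) (μ {a, b} {b})

/-- A deterministic attention rule. -/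
def Deterministic (μ : Finset α → Finset α → ℝ) : Prop :=
  ∀ S T : Finset α, S.Nonempty → μ S T = 0 ∨ μ S T = 1

theorem mem_lowerContour {r : α → α → Prop} {a b : α} :
    b ∈ lowerContour r a ↔ b = a ∨ r a b := by
  simp [lowerContour]

theorem isBest_lowerContour_inter_iff {r : α → α → Prop} (hr : IsPref r) {S : Finset α} {a b : α}
    (ha : a ∈ S) : IsBest r b (lowerContour r a ∩ S) ↔ b = a := by
  simp only [IsBest, Finset.mem_inter, mem_lowerContour]
  constructor
  · rintro ⟨⟨hab | hab, -⟩, hbest⟩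
    · exact hab
    · by_contra hne
      exact hr.asymm a b hab (hbest a ⟨Or.inl rfl, ha⟩ (Ne.symm hne))
  · rintro rfl
    exact ⟨⟨Or.inl rfl, ha⟩, fun c hc hne => hc.1.resolve_left hne⟩

/-- The attention rule that, in the choice problem `S`, considers the lower contour set of `a`
within `S` with probability `π S a`. -/
noncomputable def triangularAttention (π : Finset α → α → ℝ) (r : α → α → Prop)
    (S T : Finset α) : ℝ :=
  ∑ a ∈ S, if T = lowerContour r a ∩ S then π S a else 0

theorem isAttentionRule_triangularAttention {π : Finset α → α → ℝ} (hπ : IsChoiceRule π)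
    (r : α → α → Prop) : IsAttentionRule (triangularAttention π r) := by
  intro S hS
  obtain ⟨hnonneg, -, hsum⟩ := hπ S hS
  refine ⟨fun T _ _ => Finset.sum_nonneg fun a ha => ?_, fun T hT => ?_, ?_⟩
  · split_ifs
    exacts [hnonneg a ha, le_rfl]
  · refine Finset.sum_eq_zero fun a ha => if_neg ?_
    rintro rfl
    exact hT ⟨Finset.inter_subset_right,
      a, Finset.mem_inter.2 ⟨mem_lowerContour.2 (Or.inl rfl), ha⟩⟩
  · simp only [triangularAttention]
    rw [Finset.sum_comm, ← hsum]
    refine Finset.sum_congr rfl fun a _ => ?_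
    rw [Finset.sum_ite_eq', if_pos (Finset.mem_powerset.2 Finset.inter_subset_right)]

theorem represents_triangularAttention {π : Finset α → α → ℝ} {r : α → α → Prop}
    (hπ : IsChoiceRule π) (hr : IsPref r) : Represents π r (triangularAttention π r) := by
  refine ⟨hπ, hr, isAttentionRule_triangularAttention hπ r, fun S _ a ha => ?_⟩
  have hswap : ∀ T : Finset α, (if IsBest r a T then triangularAttention π r S T else 0) =
      ∑ x ∈ S, if T = lowerContour r x ∩ S then (if IsBest r a T then π S x else 0) else 0 := by
    intro T
    by_cases hT : IsBest r a T <;> simp [hT, triangularAttention]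
  have hterm : ∀ x ∈ S, (∑ T ∈ S.powerset,
      if T = lowerContour r x ∩ S then (if IsBest r a T then π S x else 0) else 0) =
      if a = x then π S x else 0 := by
    intro x hx
    rw [Finset.sum_ite_eq', if_pos (Finset.mem_powerset.2 Finset.inter_subset_right)]
    simp only [isBest_lowerContour_inter_iff hr hx]
  rw [Finset.sum_congr rfl fun T _ => hswap T, Finset.sum_comm, Finset.sum_congr rfl hterm,
    Finset.sum_ite_eq, if_pos ha]

theorem monotonicAttention_triangularAttention {π : Finset α → α → ℝ} {r : α → α → Prop}
    (hπ : IsChoiceRule π) (hr : IsPref r)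
    (h : ∀ S : Finset α, ∀ a ∈ S, ∀ b ∈ S, r a b → π S b ≤ π (S.erase a) b) :
    MonotonicAttention (triangularAttention π r) := by
  intro S T _ hTS hT a ha haT
  have ha_zero : (if T = lowerContour r a ∩ S then π S a else 0) = 0 := by
    refine if_neg ?_
    rintro rfl
    exact haT (Finset.mem_inter.2 ⟨mem_lowerContour.2 (Or.inl rfl), ha⟩)
  unfold triangularAttention
  rw [← Finset.add_sum_erase S _ ha, ha_zero, zero_add]
  refine Finset.sum_le_sum fun x hx => ?_
  obtain ⟨hxa, hxS⟩ := Finset.mem_erase.1 hx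
  by_cases hTx : T = lowerContour r x ∩ S
  · have hax : a ∉ lowerContour r x := fun hmem =>
      haT (hTx ▸ Finset.mem_inter.2 ⟨hmem, ha⟩)
    have hrax : r a x := (hr.total a x (Ne.symm hxa)).resolve_right
      fun hxr => hax (mem_lowerContour.2 (Or.inr hxr))
    have hTx' : T = lowerContour r x ∩ S.erase a := by
      rw [Finset.inter_erase, ← hTx, Finset.erase_eq_of_notMem haT]
    rw [if_pos hTx, if_pos hTx']
    exact h S a ha x hxS hrax
  · rw [if_neg hTx]
    split_ifs
    exacts [(hπ _ ⟨x, hx⟩).1 x hx, le_rfl]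

theorem IsRAM.le_erase {π : Finset α → α → ℝ} {r : α → α → Prop} {μ : Finset α → Finset α → ℝ}
    (h : IsRAM π r μ) {S : Finset α} {a b : α} (ha : a ∈ S) (hb : b ∈ S) (hab : r a b) :
    π S b ≤ π (S.erase a) b := by
  obtain ⟨⟨-, hr, -, hrep⟩, hmono⟩ := h
  have hne : b ≠ a := by
    rintro rfl
    exact hr.asymm b b hab hab
  have hb' : b ∈ S.erase a := Finset.mem_erase.2 ⟨hne, hb⟩
  rw [hrep S ⟨b, hb⟩ b hb, hrep _ ⟨b, hb'⟩ b hb',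
    ← Finset.sum_subset (Finset.powerset_mono.2 (Finset.erase_subset a S))]
  · refine Finset.sum_le_sum fun T hT => ?_
    have hTS := Finset.mem_powerset.1 hT
    split_ifs with hbest
    · exact hmono S T ⟨b, hb⟩ (hTS.trans (Finset.erase_subset a S)) ⟨b, hbest.1⟩ a ha
        fun haT => Finset.notMem_erase a S (hTS haT)
    · exact le_rfl
  · intro T hT hT'
    refine if_neg fun hbest => hT' (Finset.mem_powerset.2 (Finset.subset_erase.2
      ⟨Finset.mem_powerset.1 hT, fun haT => ?_⟩))
    exact hr.asymm a b hab (hbest.2 a haT (Ne.symm hne))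

/-- Theorem 3, Nonparametric Identification: There exists a
monotonic attention rule `μ` with `(≻, μ)` a RAM representation of `π` iff for
every choice problem `S` and all `a, b ∈ S` with `a ≻ b`,
`π(b|S) − π(b|S−a) ≤ 0`. -/
theorem stmt6 (π : Finset α → α → ℝ) (r : α → α → Prop)
    (hπ : IsChoiceRule π) (hr : IsPref r) :
    (∃ μ : Finset α → Finset α → ℝ, IsRAM π r μ) ↔
      ∀ S : Finset α, S.Nonempty → ∀ a ∈ S, ∀ b ∈ S, r a b →
        π S b - π (S.erase a) b ≤ 0 := by
  simp only [sub_nonpos]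
  constructor
  · rintro ⟨μ, hμ⟩ S - a ha b hb hab
    exact hμ.le_erase ha hb hab
  · intro h
    exact ⟨triangularAttention π r, represents_triangularAttention hπ hr,
      monotonicAttention_triangularAttention hπ hr fun S a ha => h S ⟨a, ha⟩ a ha⟩
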